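/- Let k ∈ ℕ, ε, β, δ > 0 and p ∈ (0,1]. Then there exists n₀ ∈ ℕ such that for any (p,λ)-bijumbled graph G on n ≥ n₀ vertices with λ ≤ ε p² n the following holds. Let U, W ⊆ V(G) be vertex subsets with |U| ≥ β n, with s := 2^k dividing |U|, and such that deg(w, U) ≥ δ p |U| for all w ∈ W. Then there exists a partition U = U₁ ∪ ⋯ ∪ U_s into pairwise disjoint sets with |Uᵢ| = |U|/s for every i ∈ [s], such that deg(w, Uᵢ) ≥ δ p |Uᵢ| / 2 for all w ∈ W and all i ∈ [s]. -/

import Mathlib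

open Finset

/-- The number of pairs `(a,b) ∈ A × B` with `ab` an edge of `G`
(edges inside `A ∩ B` are counted twice). -/
def ePairs {V : Type} [DecidableEq V] (G : SimpleGraph V) [DecidableRel G.Adj]
    (A B : Finset V) : ℕ :=
  ((A ×ˢ B).filter fun ab => G.Adj ab.1 ab.2).card

/-- `G` is `(p,λ)`-bijumbled: `|e(A,B) − p|A||B|| < λ√(|A||B|)` for all (nonempty)
vertex subsets `A, B`. -/
def Bijumbled {V : Type} [Fintype V] [DecidableEq V] (G : SimpleGraph V)
    [DecidableRel G.Adj] (p lam : ℝ) : Prop :=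
  ∀ A B : Finset V, A.Nonempty → B.Nonempty →
    |(ePairs G A B : ℝ) - p * A.card * B.card| < lam * Real.sqrt (A.card * B.card)

/-- `degIn G v U` is the number of neighbours of `v` in `U`, i.e. `|N_G(v) ∩ U|`. -/
def degIn {V : Type} [DecidableEq V] (G : SimpleGraph V) [DecidableRel G.Adj]
    (v : V) (U : Finset V) : ℕ :=
  (U.filter fun u => G.Adj v u).card

/-- Derandomised Chernoff bound for equipartitions: a set of `s * m` elements can be coloured with
`s` colours, each used `m` times, so that the exponential moments of the deficits of all weights `a w`
on all colour classes are on average at most `1`. -/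
theorem exists_equicoloring_sum_exp_le {ι V : Type*} [DecidableEq V] (s : ℕ) [NeZero s]
    (W : Finset ι) (a : ι → V → ℝ) (κ : ℝ)
    (ha : ∀ w ∈ W, ∀ u, Real.exp (-a w u) ≤ 1 - κ * a w u) (m : ℕ) :
    ∀ U : Finset V, U.card = s * m →
      ∃ c : V → Fin s, (∀ i, (U.filter fun u => c u = i).card = m) ∧
        ∑ w ∈ W, ∑ i, Real.exp (κ / s * ∑ u ∈ U, a w u - ∑ u ∈ U with c u = i, a w u)
          ≤ W.card * s := by
  induction m with
  | zero =>
    intro U hU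
    obtain rfl : U = ∅ := by simpa using hU
    exact ⟨fun _ => 0, by simp, by simp⟩
  | succ m ih =>
    intro U hU
    have hs : (0 : ℝ) < s := by exact_mod_cast Nat.pos_of_neZero s
    obtain ⟨B, hBU, hB⟩ : ∃ B ⊆ U, B.card = s :=
      Finset.exists_subset_card_eq (by rw [hU]; exact Nat.le_mul_of_pos_right _ m.succ_pos)
    obtain ⟨c, hc, hsum⟩ := ih (U \ B) (by
      rw [Finset.card_sdiff_of_subset hBU, hU, hB, Nat.mul_succ, Nat.add_sub_cancel])
    let e : B ≃ Fin s := B.equivFinOfCardEq hB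
    let C : Fin s → V → Fin s := fun r u => if h : u ∈ B then e ⟨u, h⟩ + r else c u
    let b : Fin s → V := fun j => e.symm j
    have hbB : ∀ j, b j ∈ B := fun j => (e.symm j).2
    have hsplit : ∀ f : V → ℝ, ∑ u ∈ U, f u = ∑ u ∈ U \ B, f u + ∑ j, f (b j) := by
      intro f
      rw [← Finset.sum_sdiff hBU, ← Finset.sum_coe_sort B, ← e.symm.sum_comp]
    have hfib : ∀ r i, U.filter (fun u => C r u = i) =
        insert (b (i - r)) ((U \ B).filter fun u => c u = i) := by
      intro r i
      ext u
      by_cases hu : u ∈ B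
      · have : u = b (i - r) ↔ e ⟨u, hu⟩ + r = i := by
          rw [← eq_sub_iff_add_eq, ← Equiv.eq_symm_apply, Subtype.ext_iff]
        simp [C, hu, hBU hu, this]
      · have : u ≠ b (i - r) := fun h => hu (h ▸ hbB _)
        simp [C, hu, this]
    have hnot : ∀ r i, b (i - r) ∉ (U \ B).filter fun u => c u = i := by
      intro r i
      simp [hbB]
    have hterm : ∀ w ∈ W, ∀ i, ∑ r, Real.exp (κ / s * ∑ u ∈ U, a w u -
          ∑ u ∈ U with C r u = i, a w u) ≤
        s * Real.exp (κ / s * ∑ u ∈ U \ B, a w u - ∑ u ∈ U \ B with c u = i, a w u) := by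
      intro w hw i
      have hblock : ∑ j, Real.exp (-a w (b j)) ≤ s * Real.exp (-(κ / s * ∑ j, a w (b j))) := by
        calc ∑ j, Real.exp (-a w (b j)) ≤ ∑ j : Fin s, (1 - κ * a w (b j)) :=
              Finset.sum_le_sum fun j _ => ha w hw _
          _ = s * (-(κ / s * ∑ j, a w (b j)) + 1) := by
              rw [Finset.sum_sub_distrib, ← Finset.mul_sum]
              simp only [Finset.sum_const, Finset.card_univ, Fintype.card_fin, nsmul_eq_mul]
              field_simp
              ring
          _ ≤ _ := by gcongr; exact Real.add_one_le_exp _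
      have hexp : ∀ r, Real.exp (κ / s * ∑ u ∈ U, a w u - ∑ u ∈ U with C r u = i, a w u) =
          Real.exp (κ / s * ∑ u ∈ U \ B, a w u - ∑ u ∈ U \ B with c u = i, a w u) *
            Real.exp (κ / s * ∑ j, a w (b j)) * Real.exp (-a w (b (i - r))) := by
        intro r
        rw [hfib, Finset.sum_insert (hnot r i), hsplit, ← Real.exp_add, ← Real.exp_add]
        congr 1
        ring
      have hshift : ∑ r, Real.exp (-a w (b (i - r))) = ∑ j, Real.exp (-a w (b j)) :=
        (Equiv.subLeft i).sum_comp fun j => Real.exp (-a w (b j))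
      rw [Finset.sum_congr rfl fun r _ => hexp r, ← Finset.mul_sum, hshift]
      refine (mul_le_mul_of_nonneg_left hblock (by positivity)).trans_eq ?_
      rw [Real.exp_neg]
      field_simp
    obtain ⟨r, -, hr⟩ := Finset.exists_le_of_sum_le (s := (Finset.univ : Finset (Fin s)))
      (f := fun r => ∑ w ∈ W, ∑ i, Real.exp (κ / s * ∑ u ∈ U, a w u -
          ∑ u ∈ U with C r u = i, a w u))
      (g := fun _ => (W.card : ℝ) * s) Finset.univ_nonempty (by
        calc _ = ∑ w ∈ W, ∑ i, ∑ r, Real.exp (κ / s * ∑ u ∈ U, a w u -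
                ∑ u ∈ U with C r u = i, a w u) := by
              rw [Finset.sum_comm]
              exact Finset.sum_congr rfl fun w _ => Finset.sum_comm
          _ ≤ ∑ w ∈ W, ∑ i, s * Real.exp (κ / s * ∑ u ∈ U \ B, a w u -
                ∑ u ∈ U \ B with c u = i, a w u) :=
              Finset.sum_le_sum fun w hw => Finset.sum_le_sum fun i _ => hterm w hw i
          _ = s * ∑ w ∈ W, ∑ i, Real.exp (κ / s * ∑ u ∈ U \ B, a w u -
                ∑ u ∈ U \ B with c u = i, a w u) := by
              simp only [Finset.mul_sum]
          _ ≤ s * (W.card * s) := by gcongr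
          _ = _ := by simp)
    refine ⟨C r, fun i => ?_, hr⟩
    rw [hfib, Finset.card_insert_of_notMem (hnot r i), hc]

/-- A set of `s * m` elements can be split into `s` classes of size `m` so that each of the given
sets `{u | A w u}` retains, up to a constant factor and a logarithmic error, its share of elements
in every class. -/
theorem exists_equicoloring_card_ge {ι V : Type*} [DecidableEq V] (s : ℕ) [NeZero s]
    (W : Finset ι) (A : ι → V → Prop) [∀ w, DecidablePred (A w)] (m : ℕ) (U : Finset V)
    (hU : U.card = s * m) :
    ∃ c : V → Fin s, (∀ i, (U.filter fun u => c u = i).card = m) ∧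
      ∀ w ∈ W, ∀ i, 3 / 5 / s * ((U.filter (A w)).card : ℝ) - Real.log (W.card * s) ≤
        (((U.filter fun u => c u = i).filter (A w)).card : ℝ) := by
  obtain ⟨c, hc, hsum⟩ := exists_equicoloring_sum_exp_le s W
    (fun w u => if A w u then (1 : ℝ) else 0) (3 / 5) (by
      intro w _ u
      split_ifs
      · have := Real.exp_neg_one_lt_d9
        linarith
      · simp) m U hU
  refine ⟨c, hc, fun w hw i => ?_⟩
  have hle := (Finset.single_le_sum (fun j _ => (Real.exp_pos _).le) (Finset.mem_univ i)).trans
    ((Finset.single_le_sum (f := fun w => ∑ i, Real.exp (3 / 5 / s * ∑ u ∈ U,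
      (if A w u then (1 : ℝ) else 0) - ∑ u ∈ U with c u = i, if A w u then (1 : ℝ) else 0))
      (fun v _ => Finset.sum_nonneg fun j _ => (Real.exp_pos _).le) hw).trans hsum)
  have hlog := (Real.le_log_iff_exp_le ((Real.exp_pos _).trans_le hle)).2 hle
  simp only [Finset.sum_boole] at hlog
  linarith

/-- for `k ∈ ℕ`, `ε, β, δ > 0` and `p ∈ (0,1]`, there is `n₀` such that in
any `(p,λ)`-bijumbled graph on `n ≥ n₀` vertices with `λ ≤ ε p² n`, any set `U` with
`|U| ≥ β n` and `2^k ∣ |U|`, and any set `W` with `deg(w,U) ≥ δ p |U|` for all `w ∈ W`,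
can be split into `s = 2^k` parts of size `|U|/s` so that `deg(w,Uᵢ) ≥ δ p |Uᵢ|/2` for
all `w ∈ W` and all `i`. -/
theorem stmt13 (k : ℕ) (ε β δ p : ℝ) (hε : 0 < ε) (hβ : 0 < β) (hδ : 0 < δ)
    (hp : 0 < p) (hp1 : p ≤ 1) :
    ∃ n₀ : ℕ, ∀ (V : Type) [Fintype V] [DecidableEq V]
      (G : SimpleGraph V) [DecidableRel G.Adj],
      n₀ ≤ Fintype.card V →
      ∀ lam : ℝ, lam ≤ ε * p ^ 2 * Fintype.card V → Bijumbled G p lam →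
      ∀ U W : Finset V, β * (Fintype.card V : ℝ) ≤ U.card → 2 ^ k ∣ U.card →
      (∀ w ∈ W, δ * p * U.card ≤ (degIn G w U : ℝ)) →
      ∃ P : Fin (2 ^ k) → Finset V,
        (∀ i, P i ⊆ U) ∧
        (∀ i j, i ≠ j → Disjoint (P i) (P j)) ∧
        Finset.univ.biUnion P = U ∧
        (∀ i, (P i).card = U.card / 2 ^ k) ∧
        (∀ w ∈ W, ∀ i, δ * p * (P i).card / 2 ≤ (degIn G w (P i) : ℝ)) := by
  obtain ⟨n₀, hn₀⟩ : ∃ n₀ : ℕ, ∀ n : ℕ, n₀ ≤ n →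
      Real.log (n * (2 ^ k : ℕ)) ≤ δ * p * (β * n / (2 ^ k : ℕ)) / 10 := by
    have hC : 0 < δ * p * β / (2 ^ k : ℕ) / (2 ^ k : ℕ) / 10 := by positivity
    have ht : Filter.Tendsto (fun n : ℕ => (n : ℝ) * (2 ^ k : ℕ)) Filter.atTop Filter.atTop :=
      tendsto_natCast_atTop_atTop.atTop_mul_const (by positivity)
    obtain ⟨n₀, h⟩ := Filter.eventually_atTop.1
      (ht.eventually (Real.isLittleO_log_id_atTop.bound hC))
    refine ⟨n₀, fun n hn => (le_abs_self _).trans ((h n hn).trans_eq ?_)⟩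
    rw [id, Real.norm_of_nonneg (by positivity)]
    field_simp
  refine ⟨n₀, fun V _ _ G _ hn lam _ _ U W hU hdvd hW => ?_⟩
  obtain ⟨m, hm⟩ := hdvd
  obtain ⟨c, hc, hdeg⟩ := exists_equicoloring_card_ge (2 ^ k) W G.Adj m U hm
  have hs : (0 : ℝ) < (2 ^ k : ℕ) := by positivity
  refine ⟨fun i => U.filter fun u => c u = i, fun i => Finset.filter_subset _ _, ?_, ?_, ?_, ?_⟩
  · intro i j hij
    exact Finset.disjoint_filter.2 fun u _ hi hj => hij (hi.symm.trans hj)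
  · exact Finset.biUnion_filter_eq_of_maps_to fun u _ => Finset.mem_univ _
  · intro i
    rw [hc, hm, Nat.mul_div_cancel_left _ (by positivity)]
  · intro w hw i
    have hcard : (U.card : ℝ) = (2 ^ k : ℕ) * m := by exact_mod_cast hm
    have hlog : Real.log (W.card * (2 ^ k : ℕ)) ≤ δ * p * m / 10 := by
      have hWpos : (0 : ℝ) < W.card := by exact_mod_cast Finset.card_pos.2 ⟨w, hw⟩
      have hWn : (W.card : ℝ) ≤ Fintype.card V := by exact_mod_cast W.card_le_univ
      have hm' : β * Fintype.card V / (2 ^ k : ℕ) ≤ m := by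
        rw [div_le_iff₀' hs, ← hcard]
        exact hU
      calc _ ≤ Real.log (Fintype.card V * (2 ^ k : ℕ)) := by gcongr
        _ ≤ _ := hn₀ _ hn
        _ ≤ _ := by gcongr
    have hshare : 3 / 5 * (δ * p * m) ≤
        3 / 5 / (2 ^ k : ℕ) * ((U.filter fun u => G.Adj w u).card : ℝ) := by
      have := hW w hw
      rw [hcard, degIn] at this
      calc _ = 3 / 5 / (2 ^ k : ℕ) * (δ * p * ((2 ^ k : ℕ) * m)) := by field_simp
        _ ≤ _ := by gcongr
    have := hdeg w hw i
    rw [hc, degIn]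
    linarith
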